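/- Let a₂, b₂, h₂, g₂ be general homogeneous quadratic forms in 5 variables over ℂ, and X ⊂ ℙ⁴ the quartic defined by a₂h₂ + b₂g₂ = 0. Then the singular locus of X is exactly the set {a₂ = b₂ = h₂ = g₂ = 0}, which for general choices consists of 16 points, and each singular point is a node. -/

import Mathlib

open MvPolynomial

/-- The quadratic form in 5 variables with coefficient data c, namely
∑_{t : Fin 2 → Fin 5} c t · X_{t 0} · X_{t 1}.  Every quadratic form arises this way. -/
noncomputable def quadOf (c : (Fin 2 → Fin 5) → ℂ) : MvPolynomial (Fin 5) ℂ :=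
  ∑ t : Fin 2 → Fin 5, MvPolynomial.C (c t) * ∏ i : Fin 2, MvPolynomial.X (t i)

section Elimination

theorem aeval_pi_apply {S κ : Type} (v : κ → S → ℂ) (p : MvPolynomial κ ℂ) (s : S) :
    aeval v p s = eval (fun k => v k s) p := by
  have h : Pi.evalAlgHom ℂ (fun _ : S => ℂ) s (aeval v p) =
      aeval (fun k => v k s) p := by
    rw [← AlgHom.comp_apply, comp_aeval]; rfl
  rw [← MvPolynomial.coe_aeval_eq_eval]
  exact h

/-- Functions in an algebra generated by fewer functions than there are of them satisfy a
nontrivial polynomial relation. -/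
theorem exists_relation_of_mem_adjoin {S ι κ : Type} [Fintype ι] [Fintype κ]
    (hcard : Fintype.card κ < Fintype.card ι) (v : κ → S → ℂ) (c : ι → S → ℂ)
    (h : ∀ q, c q ∈ Algebra.adjoin ℂ (Set.range v)) :
    ∃ P : MvPolynomial ι ℂ, P ≠ 0 ∧ ∀ s, eval (fun q => c q s) P = 0 := by
  have h' : ∀ q, ∃ p : MvPolynomial κ ℂ, aeval v p = c q := fun q => by
    have := h q
    rwa [Algebra.adjoin_range_eq_range_aeval] at this
  choose p hp using h'
  have hdep : ¬ AlgebraicIndependent ℂ p := fun hind => by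
    have h1 := hind.cardinalMk_le_trdeg
    rw [MvPolynomial.trdeg_of_isDomain] at h1
    simp only [Cardinal.mk_fintype, Cardinal.lift_natCast, Nat.cast_le] at h1
    omega
  rw [algebraicIndependent_iff] at hdep
  push Not at hdep
  obtain ⟨P, hP, hP0⟩ := hdep
  refine ⟨P, hP0, fun s => ?_⟩
  have h2 : aeval c P = 0 := by
    have h3 : c = fun q => aeval v (p q) := funext fun q => (hp q).symm
    have h4 := congrArg (aeval v) hP
    rw [map_zero, ← AlgHom.comp_apply, comp_aeval] at h4
    rw [h3]; exact h4
  rw [← aeval_pi_apply, h2]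
  rfl

/-- The value at `x` of the quadratic form with coefficient data `c`. -/
noncomputable def quadVal (c : (Fin 2 → Fin 5) → ℂ) (x : Fin 5 → ℂ) : ℂ :=
  ∑ j, ∑ l, c ![j, l] * (x j * x l)

/-- The `j`-th partial derivative at `x` of the quadratic form with coefficient data `c`. -/
noncomputable def quadGrad (c : (Fin 2 → Fin 5) → ℂ) (x : Fin 5 → ℂ) (j : Fin 5) : ℂ :=
  ∑ l, (c ![j, l] + c ![l, j]) * x l

theorem card_free_coeffs (k : Fin 4) (i : Fin 5) :
    Fintype.card {q : Fin 4 × (Fin 2 → Fin 5) // ¬ (q.2 0 = i ∧ (q.1 = k ∨ q.2 1 = i))} = 92 := by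
  revert k i
  decide +kernel

theorem card_nondiag_coeffs (i : Fin 5) :
    Fintype.card {q : Fin 4 × (Fin 2 → Fin 5) // ¬ (q.2 0 = i ∧ q.2 1 = i)} = 96 := by
  revert i
  decide +kernel

/-- The diagonal coefficient at a normalized coordinate is determined by the value of the form
and the other coefficients. -/
theorem diag_coeff_mem {S : Type} (A : Subalgebra ℂ (S → ℂ)) (m : (Fin 2 → Fin 5) → S → ℂ)
    (x : Fin 5 → S → ℂ) (i : Fin 5) (hi : ∀ s, x i s = 1) (hx : ∀ j, x j ∈ A)
    (hm : ∀ t : Fin 2 → Fin 5, ¬ (t 0 = i ∧ t 1 = i) → m t ∈ A)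
    (hv : (fun s => quadVal (fun t => m t s) (fun j => x j s)) ∈ A) : m ![i, i] ∈ A := by
  have key : m ![i, i] = (fun s => quadVal (fun t => m t s) (fun j => x j s)) -
      ∑ q ∈ Finset.univ.erase (i, i), m ![q.1, q.2] * (x q.1 * x q.2) := by
    funext s
    have h1 : quadVal (fun t => m t s) (fun j => x j s) =
        ∑ q : Fin 5 × Fin 5, m ![q.1, q.2] s * (x q.1 s * x q.2 s) := by
      rw [Fintype.sum_prod_type]; rfl
    simp only [Pi.sub_apply, Finset.sum_apply, Pi.mul_apply]
    rw [h1, ← Finset.add_sum_erase _ _ (Finset.mem_univ (i, i))]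
    simp [hi]
  rw [key]
  refine sub_mem hv (sum_mem fun q hq => mul_mem (hm _ ?_) (mul_mem (hx _) (hx _)))
  rintro ⟨h1, h2⟩
  exact (Finset.mem_erase.1 hq).1 (Prod.ext h1 h2)

theorem exists_relation_of_dependent_gradients (i : Fin 5) (e : Equiv.Perm (Fin 4))
    (p v : Fin 3 → MvPolynomial (Fin 3) ℂ) :
    ∃ P : MvPolynomial (Fin 4 × (Fin 2 → Fin 5)) ℂ, P ≠ 0 ∧
      ∀ (c : Fin 4 → (Fin 2 → Fin 5) → ℂ) (x : Fin 5 → ℂ) (u : Fin 3 → ℂ), x i = 1 →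
        (∀ k : Fin 3, quadVal (c (e k.succ)) x = eval u (v k)) →
        (∀ j, quadGrad (c (e 0)) x j = ∑ k : Fin 3, eval u (p k) * quadGrad (c (e k.succ)) x j) →
        eval (fun q : Fin 4 × (Fin 2 → Fin 5) => c q.1 q.2) P = 0 := by
  let S : Type := {z : (Fin 4 → (Fin 2 → Fin 5) → ℂ) × (Fin 5 → ℂ) × (Fin 3 → ℂ) //
    z.2.1 i = 1 ∧ (∀ k : Fin 3, quadVal (z.1 (e k.succ)) z.2.1 = eval z.2.2 (v k)) ∧
    ∀ j, quadGrad (z.1 (e 0)) z.2.1 j =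
      ∑ k : Fin 3, eval z.2.2 (p k) * quadGrad (z.1 (e k.succ)) z.2.1 j}
  let cc : Fin 4 × (Fin 2 → Fin 5) → S → ℂ := fun q s => s.1.1 q.1 q.2
  let xx : Fin 5 → S → ℂ := fun j s => s.1.2.1 j
  let uu : Fin 3 → S → ℂ := fun k s => s.1.2.2 k
  let w : {q : Fin 4 × (Fin 2 → Fin 5) // ¬ (q.2 0 = i ∧ (q.1 = e 0 ∨ q.2 1 = i))} ⊕
      {j : Fin 5 // j ≠ i} ⊕ Fin 3 → S → ℂ :=
    Sum.elim (fun q => cc q) (Sum.elim (fun j => xx j) uu)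
  let A := Algebra.adjoin ℂ (Set.range w)
  have hfree : ∀ q : Fin 4 × (Fin 2 → Fin 5), ¬ (q.2 0 = i ∧ (q.1 = e 0 ∨ q.2 1 = i)) →
      cc q ∈ A := fun q hq => Algebra.subset_adjoin ⟨Sum.inl ⟨q, hq⟩, rfl⟩
  have hxi : ∀ s, xx i s = 1 := fun s => s.2.1
  have hx : ∀ j, xx j ∈ A := fun j => by
    by_cases hj : j = i
    · have : xx j = 1 := by subst hj; exact funext hxi
      rw [this]; exact one_mem _
    · exact Algebra.subset_adjoin ⟨Sum.inr (Sum.inl ⟨j, hj⟩), rfl⟩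
  have hu : ∀ r : MvPolynomial (Fin 3) ℂ, (fun s : S => eval s.1.2.2 r) ∈ A := fun r => by
    have h1 : (fun s : S => eval s.1.2.2 r) = aeval uu r := by
      funext s
      rw [aeval_pi_apply]
    rw [h1]
    have h2 : Set.range uu ⊆ A := by
      rintro _ ⟨k, rfl⟩; exact Algebra.subset_adjoin ⟨Sum.inr (Sum.inr k), rfl⟩
    have h3 : (aeval uu).range ≤ A := by
      rw [← Algebra.adjoin_range_eq_range_aeval]
      exact Algebra.adjoin_le h2
    exact h3 (AlgHom.mem_range_self _ r)
  have hother : ∀ (k : Fin 3) (t : Fin 2 → Fin 5), cc (e k.succ, t) ∈ A := fun k t => by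
    have hne : e k.succ ≠ e 0 := fun h => Fin.succ_ne_zero k (e.injective h)
    by_cases ht : t 0 = i ∧ t 1 = i
    · have : t = ![i, i] := by ext a; fin_cases a <;> simp [ht]
      rw [this]
      refine diag_coeff_mem A (fun t => cc (e k.succ, t)) xx i hxi hx
        (fun t ht => hfree _ fun h => ht ⟨h.1, h.2.resolve_left hne⟩) ?_
      convert hu (v k) using 2 with s
      exact s.2.2.1 k
    · exact hfree _ fun h => ht ⟨h.1, h.2.resolve_left hne⟩
  have hgrad : ∀ j, (fun s : S => quadGrad (s.1.1 (e 0)) s.1.2.1 j) ∈ A := fun j => by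
    have h1 : (fun s : S => quadGrad (s.1.1 (e 0)) s.1.2.1 j) = ∑ k : Fin 3,
        (fun s : S => eval s.1.2.2 (p k)) *
          ∑ l, (cc (e k.succ, ![j, l]) + cc (e k.succ, ![l, j])) * xx l := by
      funext s
      simp only [Finset.sum_apply, Pi.mul_apply, Pi.add_apply]
      exact s.2.2.2 j
    rw [h1]
    exact sum_mem fun k _ => mul_mem (hu _) (sum_mem fun l _ =>
      mul_mem (add_mem (hother _ _) (hother _ _)) (hx _))
  have hgrad' : ∀ j, cc (e 0, ![i, j]) + cc (e 0, ![j, i]) =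
      (fun s : S => quadGrad (s.1.1 (e 0)) s.1.2.1 j) -
        ∑ l ∈ Finset.univ.erase i, (cc (e 0, ![j, l]) + cc (e 0, ![l, j])) * xx l := fun j => by
    funext s
    simp only [Pi.sub_apply, Finset.sum_apply, Pi.mul_apply, Pi.add_apply, quadGrad]
    rw [← Finset.add_sum_erase _ _ (Finset.mem_univ i)]
    have := hxi s
    simp only [xx, cc] at this ⊢
    rw [this]
    ring
  have hrow : ∀ j, j ≠ i → cc (e 0, ![i, j]) ∈ A := fun j hj => by
    rw [eq_sub_of_add_eq (hgrad' j)]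
    refine sub_mem (sub_mem (hgrad j) (sum_mem fun l hl => mul_mem (add_mem ?_ ?_) (hx l))) ?_
    · exact hfree _ fun h => hj h.1
    · exact hfree _ fun h => (Finset.mem_erase.1 hl).1 h.1
    · exact hfree _ fun h => hj h.1
  have hdiag : cc (e 0, ![i, i]) ∈ A := by
    have h1 : cc (e 0, ![i, i]) = (1 / 2 : ℂ) • (cc (e 0, ![i, i]) + cc (e 0, ![i, i])) := by
      rw [← two_smul ℂ, smul_smul]; norm_num
    rw [h1, hgrad' i]
    refine A.smul_mem (sub_mem (hgrad i) (sum_mem fun l hl => mul_mem (add_mem ?_ ?_) (hx l))) _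
    · exact hrow l (Finset.mem_erase.1 hl).1
    · exact hfree _ fun h => (Finset.mem_erase.1 hl).1 h.1
  have hall : ∀ q, cc q ∈ A := by
    rintro ⟨k, t⟩
    obtain ⟨k, rfl⟩ := e.surjective k
    refine Fin.cases ?_ (fun k => ?_) k
    · by_cases h0 : t 0 = i
      · have : t = ![i, t 1] := by ext a; fin_cases a <;> simp [h0]
        rw [this]
        by_cases h1 : t 1 = i
        · rw [h1]; exact hdiag
        · exact hrow _ h1
      · exact hfree _ fun h => h0 h.1
    · exact hother k t
  have hcard : Fintype.card {j : Fin 5 // j ≠ i} = 4 := by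
    clear * -
    revert i; decide
  obtain ⟨P, hP, hP'⟩ := exists_relation_of_mem_adjoin (by
    simp only [Fintype.card_sum, card_free_coeffs, hcard]
    simp) w cc hall
  exact ⟨P, hP, fun c x u h1 h2 h3 => hP' ⟨(c, x, u), h1, h2, h3⟩⟩

theorem exists_relation_of_zero_in_hyperplane (i : Fin 5) (hi0 : i ≠ 0) :
    ∃ P : MvPolynomial (Fin 4 × (Fin 2 → Fin 5)) ℂ, P ≠ 0 ∧
      ∀ (c : Fin 4 → (Fin 2 → Fin 5) → ℂ) (x : Fin 5 → ℂ), x i = 1 → x 0 = 0 →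
        (∀ k, quadVal (c k) x = 0) →
        eval (fun q : Fin 4 × (Fin 2 → Fin 5) => c q.1 q.2) P = 0 := by
  let S : Type := {z : (Fin 4 → (Fin 2 → Fin 5) → ℂ) × (Fin 5 → ℂ) //
    z.2 i = 1 ∧ z.2 0 = 0 ∧ ∀ k, quadVal (z.1 k) z.2 = 0}
  let cc : Fin 4 × (Fin 2 → Fin 5) → S → ℂ := fun q s => s.1.1 q.1 q.2
  let xx : Fin 5 → S → ℂ := fun j s => s.1.2 j
  let w : {q : Fin 4 × (Fin 2 → Fin 5) // ¬ (q.2 0 = i ∧ q.2 1 = i)} ⊕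
      {j : Fin 5 // ¬ (j = i ∨ j = 0)} → S → ℂ :=
    Sum.elim (fun q => cc q) (fun j => xx j)
  let A := Algebra.adjoin ℂ (Set.range w)
  have hfree : ∀ q : Fin 4 × (Fin 2 → Fin 5), ¬ (q.2 0 = i ∧ q.2 1 = i) →
      cc q ∈ A := fun q hq => Algebra.subset_adjoin ⟨Sum.inl ⟨q, hq⟩, rfl⟩
  have hx : ∀ j, xx j ∈ A := fun j => by
    by_cases hj : j = i
    · have : xx j = 1 := by subst hj; exact funext fun s => s.2.1
      rw [this]; exact one_mem _
    by_cases hj0 : j = 0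
    · have : xx j = 0 := by subst hj0; exact funext fun s => s.2.2.1
      rw [this]; exact zero_mem _
    · exact Algebra.subset_adjoin ⟨Sum.inr ⟨j, by tauto⟩, rfl⟩
  have hall : ∀ q, cc q ∈ A := by
    rintro ⟨k, t⟩
    by_cases ht : t 0 = i ∧ t 1 = i
    · have : t = ![i, i] := by ext a; fin_cases a <;> simp [ht]
      rw [this]
      refine diag_coeff_mem A (fun t => cc (k, t)) xx i (fun s => s.2.1) hx
        (fun t ht => hfree _ ht) ?_
      convert zero_mem A using 1
      exact funext fun s => s.2.2.2 k
    · exact hfree _ ht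
  have hcard : Fintype.card {j : Fin 5 // ¬ (j = i ∨ j = 0)} = 3 := by
    clear * - hi0
    revert i; decide
  obtain ⟨P, hP, hP'⟩ := exists_relation_of_mem_adjoin (by
    simp only [Fintype.card_sum, card_nondiag_coeffs, hcard]
    simp) w cc hall
  exact ⟨P, hP, fun c x h1 h2 h3 => hP' ⟨(c, x), h1, h2, h3⟩⟩

end Elimination

section ZeroCount

open Filter Topology

variable {E : Type} [NormedAddCommGroup E] [NormedSpace ℂ E] [FiniteDimensional ℂ E]

theorem exists_local_zero_section {G : ℂ × E → E} (hG : ContDiff ℂ 1 G) {t : ℂ} {y : E}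
    (h0 : G (t, y) = 0) (hreg : ∀ v, fderiv ℂ G (t, y) (0, v) = 0 → v = 0) :
    ∃ ψ : ℂ → E, Tendsto ψ (𝓝 t) (𝓝 y) ∧ (∀ᶠ s in 𝓝 t, G (s, ψ s) = 0) ∧
      ∀ᶠ v in 𝓝 (t, y), G v = 0 → ψ v.1 = v.2 := by
  have : CompleteSpace E := FiniteDimensional.complete ℂ E
  have hd : HasStrictFDerivAt G (fderiv ℂ G (t, y)) (t, y) :=
    hG.contDiffAt.hasStrictFDerivAt one_ne_zero
  have hinv : (fderiv ℂ G (t, y) ∘L .inr ℂ ℂ E).IsInvertible := by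
    have hinj : Function.Injective (fderiv ℂ G (t, y) ∘L .inr ℂ ℂ E).toLinearMap :=
      (injective_iff_map_eq_zero _).2 fun v hv => hreg v (by simpa using hv)
    refine ⟨(LinearEquiv.ofInjectiveEndo _ hinj).toContinuousLinearEquiv, ?_⟩
    ext v
    rfl
  refine ⟨hd.implicitFunctionOfProdDomain hinv, hd.tendsto_implicitFunctionOfProdDomain hinv,
    ?_, ?_⟩
  · filter_upwards [hd.eventually_apply_implicitFunctionOfProdDomain hinv] with s hs
    rw [hs, h0]
  · filter_upwards [hd.eventually_apply_eq_iff_implicitFunctionOfProdDomain hinv] with v hv h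
    exact hv.1 (h.trans h0.symm)

theorem finite_zeros {G : ℂ × E → E} (hG : ContDiff ℂ 1 G) {t : ℂ}
    (hreg : ∀ y, G (t, y) = 0 → ∀ v, fderiv ℂ G (t, y) (0, v) = 0 → v = 0)
    {R : ℝ} (hR : ∀ y, G (t, y) = 0 → ‖y‖ ≤ R) : {y | G (t, y) = 0}.Finite := by
  have : ProperSpace E := FiniteDimensional.proper ℂ E
  have hcont : Continuous fun y => G (t, y) := hG.continuous.comp (by fun_prop)
  have hcl : IsClosed {y | G (t, y) = 0} := isClosed_eq hcont continuous_const
  have hcomp : IsCompact {y | G (t, y) = 0} :=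
    (isCompact_closedBall (0 : E) R).of_isClosed_subset hcl fun y hy => by simpa using hR y hy
  refine hcomp.finite ?_
  rw [isDiscrete_iff_forall_mem_exists_isOpen]
  intro y hy
  obtain ⟨ψ, -, -, hψ⟩ := exists_local_zero_section hG hy (hreg y hy)
  have h1 : ∀ᶠ y' in 𝓝 y, G (t, y') = 0 → ψ t = y' :=
    (Continuous.tendsto (f := fun y' : E => (t, y')) (by fun_prop) y).eventually hψ
  obtain ⟨V, hV, hVo, hyV⟩ := eventually_nhds_iff.1 h1
  refine ⟨V, hVo, Set.eq_singleton_iff_unique_mem.2 ⟨⟨hyV, hy⟩, fun y' hy' => ?_⟩⟩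
  rw [← hV y' hy'.1 hy'.2, hV y hyV hy]

theorem eventually_ncard_zeros_eq {G : ℂ × E → E} (hG : ContDiff ℂ 1 G) {t : ℂ}
    (hreg : ∀ y, G (t, y) = 0 → ∀ v, fderiv ℂ G (t, y) (0, v) = 0 → v = 0)
    {R : ℝ} (hR : ∀ᶠ s in 𝓝 t, ∀ y, G (s, y) = 0 → ‖y‖ ≤ R) :
    ∀ᶠ s in 𝓝 t, {y | G (s, y) = 0}.ncard = {y | G (t, y) = 0}.ncard := by
  have : ProperSpace E := FiniteDimensional.proper ℂ E
  have hfin := finite_zeros hG hreg hR.self_of_nhds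
  let Z := {y | G (t, y) = 0}
  have : Finite Z := hfin
  have hex := fun z : Z => exists_local_zero_section hG z.2 (hreg z z.2)
  choose ψ hψt hψ0 hψu using hex
  have hinj : ∀ᶠ s in 𝓝 t, ∀ z z' : Z, z ≠ z' → ψ z s ≠ ψ z' s := by
    refine eventually_all.2 fun z => eventually_all.2 fun z' => ?_
    by_cases h : z = z'
    · exact Eventually.of_forall fun s h' => absurd h h'
    · have hne : (z : E) - z' ≠ 0 := sub_ne_zero.2 fun h' => h (Subtype.ext h')
      filter_upwards [((hψt z).sub (hψt z')).eventually_ne hne] with s hs _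
      exact sub_ne_zero.1 hs
  have hcover : ∀ᶠ s in 𝓝 t, ∀ y ∈ Metric.closedBall (0 : E) R, G (s, y) = 0 →
      ∃ z : Z, ψ z s = y := by
    refine (isCompact_closedBall (0 : E) R).eventually_forall_of_forall_eventually fun y _ => ?_
    by_cases hy : G (t, y) = 0
    · filter_upwards [hψu ⟨y, hy⟩] with v hv h
      exact ⟨_, hv h⟩
    · filter_upwards [hG.continuous.continuousAt.eventually_ne hy] with v hv h
      exact absurd h hv
  filter_upwards [hR, hinj, hcover, eventually_all.2 hψ0] with s h1 h2 h3 h4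
  have hrange : {y | G (s, y) = 0} = Set.range fun z : Z => ψ z s := by
    ext y
    constructor
    · intro hy
      exact h3 y (by simpa using h1 y hy) hy
    · rintro ⟨z, rfl⟩
      exact h4 z
  rw [hrange, ← Set.image_univ, Set.ncard_image_of_injective, Set.ncard_univ]
  · rfl
  · intro z z' h
    by_contra hne
    exact h2 z z' hne h

/-- The number of zeros of a family of square systems is constant over a preconnected set of
parameters on which all zeros are nondegenerate and locally uniformly bounded. -/
theorem ncard_zeros_eq_of_isPreconnected {G : ℂ × E → E} (hG : ContDiff ℂ 1 G) {U : Set ℂ}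
    (hU : IsPreconnected U)
    (hreg : ∀ t ∈ U, ∀ y, G (t, y) = 0 → ∀ v, fderiv ℂ G (t, y) (0, v) = 0 → v = 0)
    (hR : ∀ t ∈ U, ∃ R : ℝ, ∀ᶠ s in 𝓝 t, ∀ y, G (s, y) = 0 → ‖y‖ ≤ R)
    {s t : ℂ} (hs : s ∈ U) (ht : t ∈ U) :
    {y | G (s, y) = 0}.ncard = {y | G (t, y) = 0}.ncard := by
  refine hU.constant (f := fun t => {y | G (t, y) = 0}.ncard) (fun t ht => ?_) hs ht
  obtain ⟨R, hR⟩ := hR t ht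
  have h := eventually_ncard_zeros_eq hG (hreg t ht) hR
  exact (continuousAt_const.congr (h.mono fun _ h => h.symm)).continuousWithinAt

end ZeroCount

section QuadraticForms

theorem quadOf_eq_sum (c : (Fin 2 → Fin 5) → ℂ) :
    quadOf c = ∑ j, ∑ l, C (c ![j, l]) * (X j * X l) := by
  rw [← Fintype.sum_prod_type' (f := fun j l : Fin 5 =>
    (C (c ![j, l]) * (X j * X l) : MvPolynomial (Fin 5) ℂ))]
  refine Fintype.sum_equiv (finTwoArrowEquiv (Fin 5)) _ _ fun t => ?_
  have : ![t 0, t 1] = t := by ext a; fin_cases a <;> rfl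
  simp [this]

theorem eval_quadOf (c : (Fin 2 → Fin 5) → ℂ) (x : Fin 5 → ℂ) :
    eval x (quadOf c) = quadVal c x := by
  simp [quadOf_eq_sum, quadVal]

theorem eval_pderiv_quadOf (c : (Fin 2 → Fin 5) → ℂ) (x : Fin 5 → ℂ) (i : Fin 5) :
    eval x (pderiv i (quadOf c)) = quadGrad c x i := by
  have h : ∀ j l : Fin 5, eval x (pderiv i (C (c ![j, l]) * (X j * X l))) =
      c ![j, l] * (x j * (if i = l then 1 else 0) + x l * (if i = j then 1 else 0)) := fun j l => by
    rw [pderiv_C_mul]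
    simp [Derivation.leibniz, pderiv_X, Pi.single_apply, apply_ite (eval x), eq_comm]
  simp only [quadOf_eq_sum, quadGrad, map_sum, h, mul_add, add_mul, Finset.sum_add_distrib]
  rw [add_comm]
  congr 1
  · rw [Finset.sum_comm]
    simp
  · simp

theorem quadVal_smul (c : (Fin 2 → Fin 5) → ℂ) (r : ℂ) (x : Fin 5 → ℂ) :
    quadVal c (r • x) = r ^ 2 * quadVal c x := by
  simp only [quadVal, Finset.mul_sum, Pi.smul_apply, smul_eq_mul]
  exact Finset.sum_congr rfl fun j _ => Finset.sum_congr rfl fun l _ => by ring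

theorem quadGrad_smul (c : (Fin 2 → Fin 5) → ℂ) (r : ℂ) (x : Fin 5 → ℂ) (j : Fin 5) :
    quadGrad c (r • x) j = r * quadGrad c x j := by
  simp only [quadGrad, Finset.mul_sum, Pi.smul_apply, smul_eq_mul]
  exact Finset.sum_congr rfl fun l _ => by ring

theorem sum_quadGrad_mul (c : (Fin 2 → Fin 5) → ℂ) (x w : Fin 5 → ℂ) :
    ∑ j, quadGrad c x j * w j = ∑ j, ∑ l, c ![j, l] * (x j * w l + w j * x l) := by
  simp only [quadGrad, Finset.sum_mul, add_mul, mul_add, Finset.sum_add_distrib]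
  rw [add_comm]
  congr 1
  · rw [Finset.sum_comm]
    exact Finset.sum_congr rfl fun l _ => Finset.sum_congr rfl fun j _ => by ring
  · exact Finset.sum_congr rfl fun l _ => Finset.sum_congr rfl fun j _ => by ring

/-- Euler's identity for quadratic forms. -/
theorem sum_quadGrad_mul_self (c : (Fin 2 → Fin 5) → ℂ) (x : Fin 5 → ℂ) :
    ∑ j, quadGrad c x j * x j = 2 * quadVal c x := by
  rw [sum_quadGrad_mul]
  simp only [quadVal, Finset.mul_sum]
  exact Finset.sum_congr rfl fun l _ => Finset.sum_congr rfl fun j _ => by ring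

theorem quadVal_add_smul (c : (Fin 2 → Fin 5) → ℂ) (x w : Fin 5 → ℂ) (s : ℂ) :
    quadVal c (x + s • w) =
      quadVal c x + s * ∑ j, quadGrad c x j * w j + s ^ 2 * quadVal c w := by
  rw [sum_quadGrad_mul]
  simp only [quadVal, Finset.mul_sum, ← Finset.sum_add_distrib, Pi.add_apply, Pi.smul_apply,
    smul_eq_mul]
  exact Finset.sum_congr rfl fun l _ => Finset.sum_congr rfl fun j _ => by ring

end QuadraticForms

section Transverse

open Filter Topology

/-- Four quadrics meet transversally, and not in the hyperplane `x 0 = 0`. -/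
structure IsTransverse (c : Fin 4 → (Fin 2 → Fin 5) → ℂ) : Prop where
  eq_zero_of_head_eq_zero : ∀ x, x 0 = 0 → (∀ k, quadVal (c k) x = 0) → x = 0
  linearIndependent : ∀ x, x ≠ 0 → (∀ k, quadVal (c k) x = 0) →
    LinearIndependent ℂ fun k => quadGrad (c k) x

theorem exists_relation_of_not_isTransverse :
    ∃ P : MvPolynomial (Fin 4 × (Fin 2 → Fin 5)) ℂ, P ≠ 0 ∧
      ∀ c : Fin 4 → (Fin 2 → Fin 5) → ℂ,
        eval (fun q : Fin 4 × (Fin 2 → Fin 5) => c q.1 q.2) P ≠ 0 → IsTransverse c := by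
  choose P hP0 hP using fun (i : Fin 5) (e : Equiv.Perm (Fin 4)) =>
    exists_relation_of_dependent_gradients i e X 0
  choose Q hQ0 hQ using fun i : {i : Fin 5 // i ≠ 0} =>
    exists_relation_of_zero_in_hyperplane i i.2
  refine ⟨(∏ i, ∏ e, P i e) * ∏ i, Q i, mul_ne_zero
    (Finset.prod_ne_zero_iff.2 fun i _ => Finset.prod_ne_zero_iff.2 fun e _ => hP0 i e)
    (Finset.prod_ne_zero_iff.2 fun i _ => hQ0 i), fun c hc => ?_⟩
  simp only [map_mul, map_prod, mul_ne_zero_iff, Finset.prod_ne_zero_iff, Finset.mem_univ,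
    true_imp_iff] at hc
  refine ⟨fun x hx0 hx => ?_, fun x hx0 hx => ?_⟩
  · by_contra hne
    obtain ⟨i, hi⟩ := Function.ne_iff.1 hne
    have hi0 : i ≠ 0 := by rintro rfl; exact hi hx0
    refine hc.2 ⟨i, hi0⟩ (hQ ⟨i, hi0⟩ c ((x i)⁻¹ • x) ?_ ?_ fun k => ?_)
    · exact inv_mul_cancel₀ hi
    · simp [hx0]
    · rw [quadVal_smul, hx, mul_zero]
  · by_contra hdep
    rw [Fintype.linearIndependent_iff] at hdep
    push Not at hdep
    obtain ⟨l, hl, k₀, hk₀⟩ := hdep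
    obtain ⟨i, hi⟩ := Function.ne_iff.1 hx0
    let e : Equiv.Perm (Fin 4) := Equiv.swap 0 k₀
    have he : e 0 = k₀ := Equiv.swap_apply_left _ _
    refine hc.1 i e (hP i e c ((x i)⁻¹ • x) (fun k => -(l (e k.succ) / l k₀)) ?_ (fun k => ?_)
      fun j => ?_)
    · exact inv_mul_cancel₀ hi
    · rw [quadVal_smul, hx]; simp
    · have h1 := congrFun hl j
      rw [← Equiv.sum_comp e, Fin.sum_univ_succ, he] at h1
      simp only [Pi.add_apply, Finset.sum_apply, Pi.smul_apply, smul_eq_mul, Pi.zero_apply] at h1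
      simp only [quadGrad_smul, eval_X, he]
      have h2 : quadGrad (c k₀) x j =
          -(∑ k : Fin 3, l (e k.succ) * quadGrad (c (e k.succ)) x j) / l k₀ := by
        rw [eq_div_iff hk₀]; linear_combination h1
      rw [h2, neg_div, Finset.sum_div, ← Finset.sum_neg_distrib, Finset.mul_sum]
      exact Finset.sum_congr rfl fun k _ => by ring

/-- For general quadratic forms, a singular point of `a * h + b * g` lies on `h = 0`. -/
theorem exists_relation_of_singular (e : Equiv.Perm (Fin 4)) :
    ∃ P : MvPolynomial (Fin 4 × (Fin 2 → Fin 5)) ℂ, P ≠ 0 ∧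
      ∀ c : Fin 4 → (Fin 2 → Fin 5) → ℂ,
        eval (fun q : Fin 4 × (Fin 2 → Fin 5) => c q.1 q.2) P ≠ 0 →
        ∀ x, x ≠ 0 →
          quadVal (c (e 0)) x * quadVal (c (e 1)) x +
            quadVal (c (e 2)) x * quadVal (c (e 3)) x = 0 →
          (∀ j, quadVal (c (e 0)) x * quadGrad (c (e 1)) x j +
            quadGrad (c (e 0)) x j * quadVal (c (e 1)) x +
            (quadVal (c (e 2)) x * quadGrad (c (e 3)) x j +
              quadGrad (c (e 2)) x j * quadVal (c (e 3)) x) = 0) →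
          quadVal (c (e 1)) x = 0 := by
  choose P hP0 hP using fun i : Fin 5 => exists_relation_of_dependent_gradients i e
    ![X 0 * X 1, -X 0, -X 1] ![X 2, X 1 * X 2, X 0 * X 2]
  refine ⟨∏ i, P i, Finset.prod_ne_zero_iff.2 fun i _ => hP0 i, fun c hc x hx hF hdF => ?_⟩
  simp only [map_prod, Finset.prod_ne_zero_iff, Finset.mem_univ, true_imp_iff] at hc
  by_contra hh
  obtain ⟨i, hi⟩ := Function.ne_iff.1 hx
  rw [Pi.zero_apply] at hi
  refine hc i (hP i c ((x i)⁻¹ • x)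
    ![quadVal (c (e 3)) x / quadVal (c (e 1)) x, quadVal (c (e 2)) x / quadVal (c (e 1)) x,
      (x i)⁻¹ ^ 2 * quadVal (c (e 1)) x] (inv_mul_cancel₀ hi) (fun k => ?_) fun j => ?_)
  · rw [quadVal_smul]
    fin_cases k
    · simp
    · change _ * quadVal (c (e 2)) x = _
      simp
      field_simp
    · change _ * quadVal (c (e 3)) x = _
      simp
      field_simp
  · simp only [quadGrad_smul, Fin.sum_univ_three]
    change _ = _ * (_ * quadGrad (c (e 1)) x j) + _ * (_ * quadGrad (c (e 2)) x j) +
      _ * (_ * quadGrad (c (e 3)) x j)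
    simp
    field_simp
    linear_combination quadVal (c (e 1)) x * hdF j - quadGrad (c (e 1)) x j * hF

theorem exists_eq_smul_of_linearIndependent {g : Fin 4 → Fin 5 → ℂ} (hg : LinearIndependent ℂ g)
    {x w : Fin 5 → ℂ} (hx0 : x ≠ 0) (hx : ∀ k, ∑ j, g k j * x j = 0)
    (hw : ∀ k, ∑ j, g k j * w j = 0) : ∃ r : ℂ, w = r • x := by
  let M : Matrix (Fin 4) (Fin 5) ℂ := Matrix.of g
  have hrank : Module.finrank ℂ (LinearMap.range M.mulVecLin) = 4 := by
    have : M.rank = Fintype.card (Fin 4) := LinearIndependent.rank_matrix hg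
    rwa [Fintype.card_fin] at this
  have hker : Module.finrank ℂ (LinearMap.ker M.mulVecLin) = 1 := by
    have := LinearMap.finrank_range_add_finrank_ker M.mulVecLin
    rw [hrank] at this
    simp at this
    omega
  have hmem : ∀ v : Fin 5 → ℂ, (∀ k, ∑ j, g k j * v j = 0) → v ∈ LinearMap.ker M.mulVecLin :=
    fun v hv => funext hv
  obtain ⟨r, hr⟩ := (finrank_eq_one_iff_of_nonzero' (⟨x, hmem x hx⟩ : LinearMap.ker M.mulVecLin)
    (fun h => hx0 (congrArg Subtype.val h))).1 hker ⟨w, hmem w hw⟩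
  exact ⟨r, (congrArg Subtype.val hr).symm⟩

/-- Coefficient data of the four quadratic forms `x (k + 1) ^ 2 - x 0 ^ 2`. -/
noncomputable def diagCoeff (k : Fin 4) (t : Fin 2 → Fin 5) : ℂ :=
  (if t 0 = k.succ ∧ t 1 = k.succ then 1 else 0) - (if t 0 = 0 ∧ t 1 = 0 then 1 else 0)

theorem quadVal_diagCoeff (k : Fin 4) (x : Fin 5 → ℂ) :
    quadVal (diagCoeff k) x = x k.succ ^ 2 - x 0 ^ 2 := by
  simp [quadVal, diagCoeff, ite_and, sub_mul, Finset.sum_sub_distrib, sq]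

theorem quadGrad_diagCoeff (k l : Fin 4) (x : Fin 5 → ℂ) :
    quadGrad (diagCoeff k) x l.succ = if l = k then 2 * x k.succ else 0 := by
  by_cases h : l = k <;>
    simp [quadGrad, diagCoeff, h, add_mul, Finset.sum_add_distrib, two_mul]

theorem isTransverse_diagCoeff : IsTransverse diagCoeff := by
  have key : ∀ x : Fin 5 → ℂ, x 0 = 0 → (∀ k : Fin 4, x k.succ ^ 2 - x 0 ^ 2 = 0) → x = 0 :=
    fun x h0 h => funext fun j => by
      refine Fin.cases h0 (fun k => ?_) j
      simpa [h0] using h k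
  refine ⟨fun x h0 h => key x h0 fun k => by rw [← quadVal_diagCoeff, h], fun x hx h' => ?_⟩
  have h : ∀ k : Fin 4, x k.succ ^ 2 - x 0 ^ 2 = 0 := fun k => by rw [← quadVal_diagCoeff, h']
  refine Fintype.linearIndependent_iff.2 fun l hl k => ?_
  have h1 := congrFun hl k.succ
  simp only [Finset.sum_apply, Pi.smul_apply, quadGrad_diagCoeff, smul_eq_mul, mul_ite, mul_zero,
    Finset.sum_ite_eq, Finset.mem_univ, if_true, Pi.zero_apply] at h1
  refine (mul_eq_zero.1 h1).resolve_right fun h2 => hx (key x ?_ h)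
  have h3 := h k
  have h4 : x k.succ = 0 := by simpa using h2
  simpa [h4] using h3

theorem ncard_zeros_diagCoeff :
    {y : Fin 4 → ℂ | ∀ k, quadVal (diagCoeff k) (Fin.cons 1 y) = 0}.ncard = 16 := by
  have h : {y : Fin 4 → ℂ | ∀ k, quadVal (diagCoeff k) (Fin.cons 1 y) = 0} =
      (Fintype.piFinset fun _ : Fin 4 => ({1, -1} : Finset ℂ) : Finset (Fin 4 → ℂ)) := by
    ext y
    simp [quadVal_diagCoeff, sub_eq_zero]
  have h1 : (1 : ℂ) ≠ -1 := by norm_num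
  rw [h, Set.ncard_coe_finset, Fintype.card_piFinset]
  simp [Finset.card_pair h1]

/-- The affine part of the linear pencil of systems of quadrics through `c₀` and `c₁`. -/
noncomputable def pencil (c₀ c₁ : Fin 4 → (Fin 2 → Fin 5) → ℂ) (z : ℂ × (Fin 4 → ℂ)) :
    Fin 4 → ℂ :=
  fun k => quadVal (fun t => c₀ k t + z.1 * (c₁ k t - c₀ k t)) (Fin.cons 1 z.2)

theorem contDiff_pencil (c₀ c₁ : Fin 4 → (Fin 2 → Fin 5) → ℂ) : ContDiff ℂ 1 (pencil c₀ c₁) := by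
  have h : ∀ j : Fin 5, ContDiff ℂ 1 fun z : ℂ × (Fin 4 → ℂ) =>
      (Fin.cons 1 z.2 : Fin 5 → ℂ) j := fun j => by
    refine Fin.cases ?_ (fun k => ?_) j
    · exact contDiff_const
    · simp only [Fin.cons_succ]; fun_prop
  refine contDiff_pi.2 fun k => ?_
  unfold pencil quadVal
  refine ContDiff.sum fun j _ => ContDiff.sum fun l _ => ContDiff.mul (by fun_prop) ?_
  exact (h j).mul (h l)

theorem fderiv_pencil_apply (c₀ c₁ : Fin 4 → (Fin 2 → Fin 5) → ℂ) (t : ℂ) (y v : Fin 4 → ℂ)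
    (k : Fin 4) : fderiv ℂ (pencil c₀ c₁) (t, y) (0, v) k =
      ∑ j, quadGrad (fun q => c₀ k q + t * (c₁ k q - c₀ k q)) (Fin.cons 1 y) j *
        (Fin.cons 0 v : Fin 5 → ℂ) j := by
  have h1 : HasFDerivAt (pencil c₀ c₁) (fderiv ℂ (pencil c₀ c₁) (t, y)) ((t, y) + (0 : ℂ) • (0, v)) := by
    simpa using ((contDiff_pencil c₀ c₁).differentiable one_ne_zero (t, y)).hasFDerivAt
  have h2 : HasDerivAt (fun s : ℂ => (t, y) + s • ((0 : ℂ), v)) ((0 : ℂ), v) 0 := by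
    simpa using ((hasDerivAt_id (0 : ℂ)).smul_const ((0 : ℂ), v)).const_add (t, y)
  have h3 := hasDerivAt_pi.1 (h1.comp_hasDerivAt (0 : ℂ) h2) k
  refine h3.unique ?_
  set q : (Fin 2 → Fin 5) → ℂ := fun q => c₀ k q + t * (c₁ k q - c₀ k q)
  have h4 : (fun s : ℂ => (pencil c₀ c₁ ∘ fun s : ℂ => (t, y) + s • ((0 : ℂ), v)) s k) =
      fun s => quadVal q (Fin.cons 1 y) +
        s * ∑ j, quadGrad q (Fin.cons 1 y) j * (Fin.cons 0 v : Fin 5 → ℂ) j +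
        s ^ 2 * quadVal q (Fin.cons 0 v) := by
    funext s
    rw [← quadVal_add_smul]
    have : (Fin.cons 1 y + s • Fin.cons 0 v : Fin 5 → ℂ) = Fin.cons 1 (y + s • v) := by
      funext j
      refine Fin.cases ?_ (fun k => ?_) j <;> simp
    rw [this]
    simp [pencil, q]
  rw [h4]
  have h5 := (((hasDerivAt_id (0 : ℂ)).mul_const
    (∑ j, quadGrad q (Fin.cons 1 y) j * (Fin.cons 0 v : Fin 5 → ℂ) j)).const_add
    (quadVal q (Fin.cons 1 y))).add (((hasDerivAt_id (0 : ℂ)).pow 2).mul_const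
    (quadVal q (Fin.cons 0 v)))
  simp at h5
  exact h5

theorem eventually_bounded_zeros_pencil (c₀ c₁ : Fin 4 → (Fin 2 → Fin 5) → ℂ) (t : ℂ)
    (ht : IsTransverse fun k q => c₀ k q + t * (c₁ k q - c₀ k q)) :
    ∃ R : ℝ, ∀ᶠ s in 𝓝 t, ∀ y, pencil c₀ c₁ (s, y) = 0 → ‖y‖ ≤ R := by
  let Φ : ℂ × (Fin 5 → ℂ) → ℝ := fun z =>
    ‖z.2 0‖ + ∑ k, ‖quadVal (fun q => c₀ k q + z.1 * (c₁ k q - c₀ k q)) z.2‖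
  have hΦ : Continuous Φ := by
    simp only [Φ, quadVal]
    fun_prop
  have hpos : ∀ x ∈ Metric.sphere (0 : Fin 5 → ℂ) 1, 0 < Φ (t, x) := fun x hx => by
    by_contra hle
    have h0 : ∀ k ∈ Finset.univ,
        0 ≤ ‖quadVal (fun q => c₀ k q + t * (c₁ k q - c₀ k q)) x‖ := fun k _ => norm_nonneg _
    have hs := Finset.sum_nonneg h0
    have h1 : ‖x 0‖ + ∑ k, ‖quadVal (fun q => c₀ k q + t * (c₁ k q - c₀ k q)) x‖ ≤ 0 :=
      not_lt.1 hle
    have h2 := norm_nonneg (x 0)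
    have h3 : ‖x 0‖ = 0 := by linarith
    have h4 := (Finset.sum_eq_zero_iff_of_nonneg h0).1 (by linarith)
    have h5 := ht.eq_zero_of_head_eq_zero x (norm_eq_zero.1 h3)
      fun k => norm_eq_zero.1 (h4 k (Finset.mem_univ k))
    simp [h5] at hx
  have hK := isCompact_sphere (0 : Fin 5 → ℂ) 1
  obtain ⟨ε, hε, hmin⟩ := hK.exists_forall_le' (f := fun x => Φ (t, x))
    (hΦ.comp (by fun_prop)).continuousOn hpos
  have hev : ∀ᶠ s in 𝓝 t, ∀ x ∈ Metric.sphere (0 : Fin 5 → ℂ) 1, ε / 2 < Φ (s, x) :=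
    hK.eventually_forall_of_forall_eventually fun x hx =>
      hΦ.continuousAt.eventually_const_lt (by have := hmin x hx; linarith)
  refine ⟨2 / ε, ?_⟩
  filter_upwards [hev] with s hs y hy
  set x : Fin 5 → ℂ := Fin.cons 1 y with hxdef
  have hx1 : 1 ≤ ‖x‖ := by simpa [hxdef] using norm_le_pi_norm x 0
  have hxpos : 0 < ‖x‖ := by linarith
  have h1 := hs ((‖x‖⁻¹ : ℂ) • x) (by simp [norm_smul, hxpos.ne'])
  have h2 : Φ (s, (‖x‖⁻¹ : ℂ) • x) = ‖x‖⁻¹ := by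
    have : ∀ k, quadVal (fun q => c₀ k q + s * (c₁ k q - c₀ k q)) x = 0 := fun k => congrFun hy k
    simp only [Φ, quadVal_smul, this]
    simp [hxdef]
  rw [h2, lt_inv_comm₀ (by positivity) hxpos, inv_div] at h1
  refine le_trans ?_ h1.le
  refine (pi_norm_le_iff_of_nonneg (norm_nonneg _)).2 fun k => ?_
  simpa [hxdef] using norm_le_pi_norm x k.succ

theorem zeros_of_isTransverse (P : MvPolynomial (Fin 4 × (Fin 2 → Fin 5)) ℂ)
    (hP : ∀ c : Fin 4 → (Fin 2 → Fin 5) → ℂ,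
      eval (fun q : Fin 4 × (Fin 2 → Fin 5) => c q.1 q.2) P ≠ 0 → IsTransverse c)
    (c : Fin 4 → (Fin 2 → Fin 5) → ℂ)
    (hc : eval (fun q : Fin 4 × (Fin 2 → Fin 5) => c q.1 q.2) P ≠ 0) :
    {y : Fin 4 → ℂ | ∀ k, quadVal (c k) (Fin.cons 1 y) = 0}.Finite ∧
      {y : Fin 4 → ℂ | ∀ k, quadVal (c k) (Fin.cons 1 y) = 0}.ncard = 16 := by
  let γ : ℂ → Fin 4 → (Fin 2 → Fin 5) → ℂ := fun t k q =>
    diagCoeff k q + t * (c k q - diagCoeff k q)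
  have hγ0 : γ 0 = diagCoeff := by funext k q; simp [γ]
  have hγ1 : γ 1 = c := by funext k q; simp [γ]
  let U : Set ℂ := {t | IsTransverse (γ t)}
  have hUc : Uᶜ.Finite := by
    let p : Polynomial ℂ := aeval (fun q : Fin 4 × (Fin 2 → Fin 5) =>
      Polynomial.C (diagCoeff q.1 q.2) +
        Polynomial.X * Polynomial.C (c q.1 q.2 - diagCoeff q.1 q.2)) P
    have hp : ∀ t, p.eval t = eval (fun q : Fin 4 × (Fin 2 → Fin 5) => γ t q.1 q.2) P := fun t => by
      have h := comp_aeval_apply (R := ℂ) (fun q : Fin 4 × (Fin 2 → Fin 5) =>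
        Polynomial.C (diagCoeff q.1 q.2) +
        Polynomial.X * Polynomial.C (c q.1 q.2 - diagCoeff q.1 q.2)) (Polynomial.aeval t) P
      rw [Polynomial.coe_aeval_eq_eval] at h
      rw [h, ← MvPolynomial.coe_aeval_eq_eval]
      simp [γ]
    have hp0 : p ≠ 0 := fun h => hc (by rw [← hγ1, ← hp, h, Polynomial.eval_zero])
    refine (p.roots.toFinset.finite_toSet).subset fun t ht => ?_
    simp only [Finset.mem_coe, Multiset.mem_toFinset, Polynomial.mem_roots hp0, Polynomial.IsRoot]
    by_contra h
    exact ht (hP _ (by rwa [← hp]))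
  have hU : IsPreconnected U := by
    rw [← compl_compl U]
    exact (hUc.countable.isConnected_compl_of_one_lt_rank
      (by rw [Complex.rank_real_complex]; norm_num)).isPreconnected
  have h0U : (0 : ℂ) ∈ U := by simp only [U, Set.mem_ofPred_eq, hγ0]; exact isTransverse_diagCoeff
  have h1U : (1 : ℂ) ∈ U := by simp only [U, Set.mem_ofPred_eq, hγ1]; exact hP c hc
  have hset : ∀ t, {y | pencil diagCoeff c (t, y) = 0} =
      {y : Fin 4 → ℂ | ∀ k, quadVal (γ t k) (Fin.cons 1 y) = 0} := fun t => by
    ext y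
    exact funext_iff
  have hreg : ∀ t ∈ U, ∀ y, pencil diagCoeff c (t, y) = 0 →
      ∀ v, fderiv ℂ (pencil diagCoeff c) (t, y) (0, v) = 0 → v = 0 := fun t ht y hy v hv => by
    have hx0 : (Fin.cons 1 y : Fin 5 → ℂ) ≠ 0 := fun h => one_ne_zero (congrFun h 0)
    have hy' : ∀ k, quadVal (γ t k) (Fin.cons 1 y) = 0 := fun k => congrFun hy k
    obtain ⟨r, hr⟩ := exists_eq_smul_of_linearIndependent
      (ht.linearIndependent _ hx0 hy') hx0 (w := Fin.cons 0 v)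
      (fun k => by rw [sum_quadGrad_mul_self, hy', mul_zero])
      (fun k => by rw [← fderiv_pencil_apply, hv]; rfl)
    have hr0 : r = 0 := by simpa using (congrFun hr 0).symm
    funext k
    simpa [hr0] using congrFun hr k.succ
  have hbdd := fun t (ht : t ∈ U) => eventually_bounded_zeros_pencil diagCoeff c t ht
  constructor
  · obtain ⟨R, hR⟩ := hbdd 1 h1U
    have := finite_zeros (contDiff_pencil diagCoeff c) (hreg 1 h1U) hR.self_of_nhds
    rwa [hset, hγ1] at this
  · have := ncard_zeros_eq_of_isPreconnected (contDiff_pencil diagCoeff c) hU hreg hbdd h1U h0U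
    rwa [hset, hset, hγ0, hγ1, ncard_zeros_diagCoeff] at this

end Transverse

section Nodes

theorem eval_mul_add_mul (c : Fin 4 → (Fin 2 → Fin 5) → ℂ) (x : Fin 5 → ℂ) :
    eval x (quadOf (c 0) * quadOf (c 2) + quadOf (c 1) * quadOf (c 3)) =
      quadVal (c 0) x * quadVal (c 2) x + quadVal (c 1) x * quadVal (c 3) x := by
  simp [eval_quadOf]

theorem eval_pderiv_mul_add_mul (c : Fin 4 → (Fin 2 → Fin 5) → ℂ) (x : Fin 5 → ℂ) (j : Fin 5) :
    eval x (pderiv j (quadOf (c 0) * quadOf (c 2) + quadOf (c 1) * quadOf (c 3))) =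
      quadVal (c 0) x * quadGrad (c 2) x j + quadGrad (c 0) x j * quadVal (c 2) x +
        (quadVal (c 1) x * quadGrad (c 3) x j + quadGrad (c 1) x j * quadVal (c 3) x) := by
  simp only [map_add, map_mul, pderiv_mul, eval_quadOf, eval_pderiv_quadOf]
  ring

theorem eval_pderiv_pderiv_mul_add_mul (c : Fin 4 → (Fin 2 → Fin 5) → ℂ) (x : Fin 5 → ℂ)
    (hx : ∀ k, quadVal (c k) x = 0) (i j : Fin 5) :
    eval x (pderiv i (pderiv j
      (quadOf (c 0) * quadOf (c 2) + quadOf (c 1) * quadOf (c 3)))) =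
      quadGrad (c 0) x i * quadGrad (c 2) x j + quadGrad (c 2) x i * quadGrad (c 0) x j +
        (quadGrad (c 1) x i * quadGrad (c 3) x j + quadGrad (c 3) x i * quadGrad (c 1) x j) := by
  simp only [map_add, map_mul, pderiv_mul, eval_quadOf, eval_pderiv_quadOf, hx]
  ring

/-- The quadratic form `y₀ y₂ + y₁ y₃` pulled back along four independent linear forms has
rank four. -/
theorem rank_hyperbolic_pullback {g : Fin 4 → Fin 5 → ℂ} (hg : LinearIndependent ℂ g) :
    Matrix.rank (Matrix.of fun i j : Fin 5 =>
      g 0 i * g 2 j + g 2 i * g 0 j + (g 1 i * g 3 j + g 3 i * g 1 j)) = 4 := by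
  let M : Matrix (Fin 4) (Fin 5) ℂ := Matrix.of g
  let N : Matrix (Fin 4) (Fin 5) ℂ := Matrix.of ![g 2, g 3, g 0, g 1]
  have hH : (Matrix.of fun i j : Fin 5 =>
      g 0 i * g 2 j + g 2 i * g 0 j + (g 1 i * g 3 j + g 3 i * g 1 j)) = M.transpose * N := by
    ext i j
    simp [M, N, Matrix.mul_apply, Fin.sum_univ_four]
    ring
  have hN : LinearIndependent ℂ N.row := by
    let e : Fin 4 → Fin 4 := ![2, 3, 0, 1]
    have he : Function.Injective e := by decide
    have : N.row = g ∘ e := by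
      funext k; fin_cases k <;> rfl
    rw [this]
    exact hg.comp e he
  have hM : M.rank = 4 := by
    have : M.rank = Fintype.card (Fin 4) := LinearIndependent.rank_matrix hg
    rwa [Fintype.card_fin] at this
  have hsurj : Function.Surjective N.mulVecLin := by
    rw [← LinearMap.range_eq_top]
    apply Submodule.eq_top_of_finrank_eq
    have : N.rank = Fintype.card (Fin 4) := hN.rank_matrix
    rw [Module.finrank_fintype_fun_eq_card]
    exact this
  rw [hH, Matrix.rank, Matrix.mulVecLin_mul, LinearMap.range_comp_of_range_eq_top _
    (LinearMap.range_eq_top.2 hsurj)]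
  exact (Matrix.rank_transpose M).trans hM

theorem finite_and_ncard_base_locus (c : Fin 4 → (Fin 2 → Fin 5) → ℂ) (hc : IsTransverse c)
    {n : ℕ} (hfin : {y : Fin 4 → ℂ | ∀ k, quadVal (c k) (Fin.cons 1 y) = 0}.Finite)
    (hn : {y : Fin 4 → ℂ | ∀ k, quadVal (c k) (Fin.cons 1 y) = 0}.ncard = n) :
    {x : Projectivization ℂ (Fin 5 → ℂ) | ∀ k, quadVal (c k) x.rep = 0}.Finite ∧
      {x : Projectivization ℂ (Fin 5 → ℂ) | ∀ k, quadVal (c k) x.rep = 0}.ncard = n := by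
  have hne : ∀ y : Fin 4 → ℂ, (Fin.cons 1 y : Fin 5 → ℂ) ≠ 0 :=
    fun y h => one_ne_zero (congrFun h 0)
  let φ : (Fin 4 → ℂ) → Projectivization ℂ (Fin 5 → ℂ) := fun y =>
    Projectivization.mk ℂ (Fin.cons 1 y) (hne y)
  have hφ : Function.Injective φ := fun y y' h => by
    obtain ⟨a, ha⟩ := (Projectivization.mk_eq_mk_iff' ℂ _ _ _ _).1 h
    have ha1 : a = 1 := by simpa using congrFun ha 0
    funext k
    simpa [ha1] using (congrFun ha k.succ).symm
  have himage : {x : Projectivization ℂ (Fin 5 → ℂ) | ∀ k, quadVal (c k) x.rep = 0} =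
      φ '' {y : Fin 4 → ℂ | ∀ k, quadVal (c k) (Fin.cons 1 y) = 0} := by
    ext x
    constructor
    · intro hx
      have h0 : x.rep 0 ≠ 0 := fun h0 =>
        x.rep_nonzero (hc.eq_zero_of_head_eq_zero _ h0 hx)
      have hcons : (Fin.cons 1 fun k => (x.rep 0)⁻¹ * x.rep k.succ : Fin 5 → ℂ) =
          (x.rep 0)⁻¹ • x.rep := by
        funext j
        refine Fin.cases ?_ (fun k => ?_) j <;> simp [h0]
      refine ⟨fun k => (x.rep 0)⁻¹ * x.rep k.succ, fun k => ?_, ?_⟩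
      · rw [hcons, quadVal_smul, hx k, mul_zero]
      · rw [← x.mk_rep]
        refine (Projectivization.mk_eq_mk_iff' ℂ _ _ _ _).2 ⟨(x.rep 0)⁻¹, ?_⟩
        rw [x.mk_rep, hcons]
    · rintro ⟨y, hy, rfl⟩ k
      obtain ⟨a, ha⟩ := Projectivization.exists_smul_eq_mk_rep ℂ _ (hne y)
      have h1 : (φ y).rep = (a : ℂ) • (Fin.cons 1 y : Fin 5 → ℂ) := ha.symm
      rw [h1, quadVal_smul, hy k, mul_zero]
  rw [himage]
  exact ⟨hfin.image φ, by rw [Set.ncard_image_of_injective _ hφ, hn]⟩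

end Nodes


/-- Let a₂, b₂, h₂, g₂ be general quadratic forms in 5 variables over ℂ and
X ⊂ ℙ⁴ the quartic a₂h₂ + b₂g₂ = 0. Then Sing(X) = {a₂ = b₂ = h₂ = g₂ = 0}, which consists
of 16 points, each of which is a node (the Hessian of the defining quartic has rank 4 there).
"General" means: on the complement of the zero locus of some nonzero polynomial P in the
coefficients of the four quadrics. -/
theorem stmt_15 :
    ∃ P : MvPolynomial (Fin 4 × (Fin 2 → Fin 5)) ℂ, P ≠ 0 ∧
      ∀ c : Fin 4 → (Fin 2 → Fin 5) → ℂ,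
        MvPolynomial.eval (fun q : Fin 4 × (Fin 2 → Fin 5) => c q.1 q.2) P ≠ 0 →
        ∀ F : MvPolynomial (Fin 5) ℂ,
          F = quadOf (c 0) * quadOf (c 2) + quadOf (c 1) * quadOf (c 3) →
          (∀ x : Projectivization ℂ (Fin 5 → ℂ),
            ((MvPolynomial.eval x.rep F = 0 ∧
              ∀ i : Fin 5, MvPolynomial.eval x.rep (MvPolynomial.pderiv i F) = 0) ↔
             (MvPolynomial.eval x.rep (quadOf (c 0)) = 0 ∧
              MvPolynomial.eval x.rep (quadOf (c 1)) = 0 ∧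
              MvPolynomial.eval x.rep (quadOf (c 2)) = 0 ∧
              MvPolynomial.eval x.rep (quadOf (c 3)) = 0))) ∧
          {x : Projectivization ℂ (Fin 5 → ℂ) |
            MvPolynomial.eval x.rep F = 0 ∧
            ∀ i : Fin 5, MvPolynomial.eval x.rep (MvPolynomial.pderiv i F) = 0}.Finite ∧
          {x : Projectivization ℂ (Fin 5 → ℂ) |
            MvPolynomial.eval x.rep F = 0 ∧
            ∀ i : Fin 5, MvPolynomial.eval x.rep (MvPolynomial.pderiv i F) = 0}.ncard = 16 ∧
          ∀ x : Projectivization ℂ (Fin 5 → ℂ),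
            (MvPolynomial.eval x.rep F = 0 ∧
              ∀ i : Fin 5, MvPolynomial.eval x.rep (MvPolynomial.pderiv i F) = 0) →
            Matrix.rank (Matrix.of fun i j : Fin 5 =>
              MvPolynomial.eval x.rep
                (MvPolynomial.pderiv i (MvPolynomial.pderiv j F))) = 4 := by
  obtain ⟨P, hP0, hP⟩ := exists_relation_of_not_isTransverse
  choose Q hQ0 hQ using exists_relation_of_singular
  refine ⟨P * ∏ e, Q e, mul_ne_zero hP0 (Finset.prod_ne_zero_iff.2 fun e _ => hQ0 e),
    fun c hc F hF => ?_⟩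
  subst hF
  simp only [map_mul, map_prod, mul_ne_zero_iff, Finset.prod_ne_zero_iff, Finset.mem_univ,
    true_imp_iff] at hc
  obtain ⟨hcP, hcQ⟩ := hc
  have hc := hP c hcP
  have hsing : ∀ x : Projectivization ℂ (Fin 5 → ℂ),
      (eval x.rep (quadOf (c 0) * quadOf (c 2) + quadOf (c 1) * quadOf (c 3)) = 0 ∧
        ∀ i : Fin 5, eval x.rep
          (pderiv i (quadOf (c 0) * quadOf (c 2) + quadOf (c 1) * quadOf (c 3))) = 0) ↔
      ∀ k, quadVal (c k) x.rep = 0 := fun x => by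
    simp only [eval_mul_add_mul, eval_pderiv_mul_add_mul]
    constructor
    · rintro ⟨h1, h2⟩
      have key : ∀ i j k l : Fin 4, Function.Bijective ![i, j, k, l] →
          quadVal (c i) x.rep * quadVal (c j) x.rep +
            quadVal (c k) x.rep * quadVal (c l) x.rep = 0 →
          (∀ m, quadVal (c i) x.rep * quadGrad (c j) x.rep m +
            quadGrad (c i) x.rep m * quadVal (c j) x.rep +
            (quadVal (c k) x.rep * quadGrad (c l) x.rep m +
              quadGrad (c k) x.rep m * quadVal (c l) x.rep) = 0) →
          quadVal (c j) x.rep = 0 := fun i j k l hf =>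
        hQ (Equiv.ofBijective _ hf) c (hcQ _) x.rep x.rep_nonzero
      have h0 := key 2 0 1 3 (by decide) (by linear_combination h1)
        fun m => by linear_combination h2 m
      have h1' := key 3 1 0 2 (by decide) (by linear_combination h1)
        fun m => by linear_combination h2 m
      have h2' := key 0 2 1 3 (by decide) h1 h2
      have h3 := key 1 3 0 2 (by decide) (by linear_combination h1)
        fun m => by linear_combination h2 m
      simp only [Fin.forall_fin_succ, IsEmpty.forall_iff, and_true]
      exact ⟨h0, h1', h2', h3⟩
    · intro h
      simp [h]
  obtain ⟨hfin, hcard⟩ := finite_and_ncard_base_locus c hc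
    (zeros_of_isTransverse P hP c hcP).1 (zeros_of_isTransverse P hP c hcP).2
  simp only [hsing]
  refine ⟨fun x => ?_, hfin, hcard, fun x hx => ?_⟩
  · simp [eval_quadOf, Fin.forall_fin_succ]
  · have hrank := rank_hyperbolic_pullback (hc.linearIndependent x.rep x.rep_nonzero hx)
    refine Eq.trans (congrArg Matrix.rank (Matrix.ext fun i j => ?_)) hrank
    exact eval_pderiv_pderiv_mul_add_mul c x.rep hx i j
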